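/- Let μ be a probability measure on ℝ^d, z ∈ ℝ^d, r > 0 and s > 0, let F_z = { x ↦ sig_s(r² − ‖x − c‖²) : ‖c − z‖ = r }, and let X_1,…,X_n be i.i.d. with law μ. Then for every t > 0, P( |SD^r_s(z | X_{1:n}) − SD^r_s(z | μ)| > 2·R_{μ,n}(F_z) + t ) ≤ 2·exp(−n t² / 2). -/

import Mathlib

open MeasureTheory

/-- The sigmoid function with scale `s`. -/
noncomputable def sig (s t : ℝ) : ℝ := 1 / (1 + Real.exp (-t / s))

/-- The (smoothed, `s > 0`) sphere depth
`SD^r_s(z|μ) = inf_{‖c−z‖=r} ∫ sig_s(r² − ‖x − c‖²) dμ(x)`. -/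
noncomputable def SDs (d : ℕ) (r s : ℝ) (z : EuclideanSpace ℝ (Fin d))
    (μ : Measure (EuclideanSpace ℝ (Fin d))) : ℝ :=
  ⨅ c : Metric.sphere z r, ∫ x, sig s (r ^ 2 - ‖x - (c : EuclideanSpace ℝ (Fin d))‖ ^ 2) ∂μ

/-- The sphere depth of the empirical measure of the samples `x₁,…,xₙ`:
`SD^r_s(z|x_{1:n}) = inf_{‖c−z‖=r} (1/n) Σᵢ sig_s(r² − ‖xᵢ − c‖²)`. -/
noncomputable def SDemp (d : ℕ) (r s : ℝ) (z : EuclideanSpace ℝ (Fin d)) (n : ℕ)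
    (x : Fin n → EuclideanSpace ℝ (Fin d)) : ℝ :=
  ⨅ c : Metric.sphere z r,
    (n : ℝ)⁻¹ * ∑ i, sig s (r ^ 2 - ‖x i - (c : EuclideanSpace ℝ (Fin d))‖ ^ 2)

/-- The uniform measure on `{±1}` signs, encoded on `Bool`. -/
noncomputable def signMeasure : Measure Bool := (PMF.uniformOfFintype Bool).toMeasure

/-- The Rademacher complexity `R_{P,n}(F) = E[ sup_{f ∈ F} (1/n) Σᵢ σᵢ f(Xᵢ) ]`, where the
`Xᵢ` are i.i.d. with law `P` and the `σᵢ` are independent uniform `±1` signs. -/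
noncomputable def radComp {E : Type*} [MeasurableSpace E] (P : Measure E) (n : ℕ)
    (F : Set (E → ℝ)) : ℝ :=
  ∫ x : Fin n → E, ∫ σ : Fin n → Bool,
      (⨆ f : F, (n : ℝ)⁻¹ * ∑ i, (if σ i then (1 : ℝ) else -1) * (f : E → ℝ) (x i))
    ∂(Measure.pi fun _ => signMeasure) ∂(Measure.pi fun _ => P)

/-- The class `F_z = { x ↦ sig_s(r² − ‖x − c‖²) : ‖c − z‖ = r }`. -/
def Fz (d : ℕ) (r s : ℝ) (z : EuclideanSpace ℝ (Fin d)) :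
    Set (EuclideanSpace ℝ (Fin d) → ℝ) :=
  {f | ∃ c : EuclideanSpace ℝ (Fin d), ‖c - z‖ = r ∧
    f = fun x => sig s (r ^ 2 - ‖x - c‖ ^ 2)}

open ProbabilityTheory Set

/-- McDiarmid's bounded differences inequality, as a bound on the moment generating function. -/
theorem hasSubgaussianMGF_pi_of_bounded_differences {E : Type*} [MeasurableSpace E]
    (μ : Measure E) [IsProbabilityMeasure μ] (c : NNReal) (n : ℕ) (g : (Fin n → E) → ℝ)
    (hg : Measurable g) (B : ℝ) (hB : ∀ x, |g x| ≤ B)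
    (hc : ∀ x k y, g (Function.update x k y) ≤ g x + c) :
    HasSubgaussianMGF (fun x ↦ g x - ∫ x', g x' ∂(Measure.pi fun _ ↦ μ)) (n * (c / 2) ^ 2)
      (Measure.pi fun _ ↦ μ) := by
  have hbound {n : ℕ} (g : (Fin n → E) → ℝ) (hg : Measurable g) (hB : ∀ x, |g x| ≤ B) (t : ℝ) :
      Integrable (fun x ↦ Real.exp (t * (g x - ∫ x', g x' ∂(Measure.pi fun _ ↦ μ))))
        (Measure.pi fun _ ↦ μ) := by
    refine Integrable.of_bound (by fun_prop)
      (Real.exp (|t| * (B + |∫ x', g x' ∂(Measure.pi fun _ ↦ μ)|))) (.of_forall fun x ↦ ?_)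
    rw [Real.norm_eq_abs, Real.abs_exp, Real.exp_le_exp]
    refine (le_abs_self _).trans ?_
    rw [abs_mul]
    gcongr
    exact (abs_sub _ _).trans (by gcongr; exact hB x)
  refine ⟨hbound g hg hB, fun t ↦ ?_⟩
  induction n with
  | zero =>
    have : ∀ x x' : Fin 0 → E, g x = g x' := fun x x' ↦ by rw [Subsingleton.elim x x']
    have h (x : Fin 0 → E) : g x - ∫ x', g x' ∂(Measure.pi fun _ ↦ μ) = 0 := by
      simp [this _ x]
    simp [mgf, h]
  | succ n ih =>
    set e := MeasurableEquiv.piFinSuccAbove (fun _ : Fin (n + 1) ↦ E) 0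
    have he : MeasurePreserving e.symm (μ.prod (Measure.pi fun _ : Fin n ↦ μ))
        (Measure.pi fun _ ↦ μ) := (measurePreserving_piFinSuccAbove (fun _ ↦ μ) 0).symm _
    have hgm : Measurable fun p ↦ g (e.symm p) := hg.comp e.symm.measurable
    let h : (Fin n → E) → ℝ := fun x ↦ ∫ y, g (e.symm (y, x)) ∂μ
    have hgi : Integrable (fun p ↦ g (e.symm p)) (μ.prod (Measure.pi fun _ : Fin n ↦ μ)) :=
      .of_bound hgm.aestronglyMeasurable B (.of_forall fun p ↦ hB _)
    have hgi' (x) : Integrable (fun y ↦ g (e.symm (y, x))) μ :=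
      .of_bound (hgm.comp (by fun_prop)).aestronglyMeasurable B (.of_forall fun p ↦ hB _)
    have hh : Measurable h :=
      (hgm.stronglyMeasurable.integral_prod_left' (μ := μ)).measurable
    have hhB (x) : |h x| ≤ B := by
      simpa using norm_integral_le_of_norm_le_const (μ := μ) (f := fun y ↦ g (e.symm (y, x)))
        (.of_forall fun y ↦ hB (e.symm (y, x)))
    have hupd (y y' : E) (x : Fin n → E) : e.symm (y', x) = Function.update (e.symm (y, x)) 0 y' := by
      ext k
      refine Fin.cases ?_ (fun k ↦ ?_) k <;>
        simp [e, MeasurableEquiv.piFinSuccAbove, Fin.insertNthEquiv]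
    have hupd' (y z : E) (x : Fin n → E) (k) :
        e.symm (y, Function.update x k z) = Function.update (e.symm (y, x)) k.succ z := by
      simp [e, MeasurableEquiv.piFinSuccAbove, Fin.insertNthEquiv]
    have hhc (x k z) : h (Function.update x k z) ≤ h x + c := by
      calc h (Function.update x k z) ≤ ∫ y, g (e.symm (y, x)) + c ∂μ :=
            integral_mono (hgi' _) ((hgi' _).add (integrable_const _)) fun y ↦ by
              simp only [hupd']; exact hc _ _ _
        _ = h x + c := by rw [integral_add (hgi' _) (integrable_const _)]; simp [h]
    have hmean : ∫ x, g x ∂(Measure.pi fun _ ↦ μ) = ∫ x, h x ∂(Measure.pi fun _ : Fin n ↦ μ) := by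
      rw [← he.map_eq, integral_map he.measurable.aemeasurable (hg.aestronglyMeasurable),
        integral_prod_symm _ hgi]
    set m := ∫ x, h x ∂(Measure.pi fun _ : Fin n ↦ μ)
    have hinner (x : Fin n → E) :
        ∫ y, Real.exp (t * (g (e.symm (y, x)) - h x)) ∂μ ≤ Real.exp ((c / 2) ^ 2 * t ^ 2 / 2) := by
      have : Nonempty E := nonempty_of_isProbabilityMeasure μ
      have hbdd : BddBelow (range fun y ↦ g (e.symm (y, x))) :=
        ⟨-B, by rintro _ ⟨y, rfl⟩; exact (abs_le.1 (hB _)).1⟩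
      have := (hasSubgaussianMGF_of_mem_Icc (μ := μ) (X := fun y ↦ g (e.symm (y, x)))
        (a := ⨅ y, g (e.symm (y, x))) (b := (⨅ y, g (e.symm (y, x))) + c)
        (hgm.comp (by fun_prop)).aemeasurable (.of_forall fun y ↦ ⟨ciInf_le hbdd y, ?_⟩)).mgf_le t
      · simpa [mgf] using this
      · rw [← sub_le_iff_le_add]
        refine le_ciInf fun y' ↦ ?_
        rw [sub_le_iff_le_add, hupd y' y]
        exact hc _ _ _
    have hexp := he.integrable_comp_of_integrable (hbound g hg hB t)
    rw [hmean] at hexp ⊢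
    calc mgf (fun x ↦ g x - m) (Measure.pi fun _ ↦ μ) t
        = ∫ x, ∫ y, Real.exp (t * (g (e.symm (y, x)) - m)) ∂μ ∂(Measure.pi fun _ : Fin n ↦ μ) := by
          rw [mgf, ← he.map_eq, integral_map he.measurable.aemeasurable
            (by fun_prop)]
          exact integral_prod_symm _ hexp
      _ ≤ ∫ x, Real.exp ((c / 2) ^ 2 * t ^ 2 / 2) * Real.exp (t * (h x - m))
            ∂(Measure.pi fun _ : Fin n ↦ μ) := by
          refine integral_mono hexp.integral_prod_right ((hbound h hh hhB t).const_mul _) fun x ↦ ?_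
          calc ∫ y, Real.exp (t * (g (e.symm (y, x)) - m)) ∂μ
              = (∫ y, Real.exp (t * (g (e.symm (y, x)) - h x)) ∂μ) * Real.exp (t * (h x - m)) := by
                rw [← integral_mul_const]
                congr with y
                rw [← Real.exp_add]
                ring_nf
            _ ≤ _ := by gcongr; exact hinner x
      _ ≤ Real.exp ((c / 2) ^ 2 * t ^ 2 / 2) * Real.exp ((n * (c / 2) ^ 2 : NNReal) * t ^ 2 / 2) := by
          rw [integral_const_mul]
          gcongr
          exact ih h hh hhB hhc
      _ = Real.exp (((n + 1 : ℕ) * (c / 2) ^ 2 : NNReal) * t ^ 2 / 2) := by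
          rw [← Real.exp_add]
          push_cast
          ring_nf

/-- The empirical average of `f` over the sample `x`. -/
noncomputable def empAvg {E : Type*} {n : ℕ} (f : E → ℝ) (x : Fin n → E) : ℝ :=
  (n : ℝ)⁻¹ * ∑ k, f (x k)

/-- The real sign `±1` encoded by a Boolean. -/
noncomputable def boolSign (b : Bool) : ℝ := if b then 1 else -1

/-- The supremum over a family of the sign-weighted empirical averages. -/
noncomputable def signedSup {E ι : Type*} {n : ℕ} (f : ι → E → ℝ) (σ : Fin n → Bool)
    (x : Fin n → E) : ℝ :=
  ⨆ i, (n : ℝ)⁻¹ * ∑ k, boolSign (σ k) * f i (x k)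

theorem boolSign_not (b : Bool) : boolSign (!b) = -boolSign b := by
  cases b <;> simp [boolSign]

theorem abs_boolSign (b : Bool) : |boolSign b| = 1 := by
  cases b <;> simp [boolSign]

theorem abs_inv_mul_sum_le {n : ℕ} {M : ℝ} (hM : 0 ≤ M) {a : Fin n → ℝ} (ha : ∀ k, |a k| ≤ M) :
    |(n : ℝ)⁻¹ * ∑ k, a k| ≤ M := by
  rw [abs_mul, abs_of_nonneg (by positivity : (0 : ℝ) ≤ (n : ℝ)⁻¹)]
  calc (n : ℝ)⁻¹ * |∑ k, a k| ≤ (n : ℝ)⁻¹ * (n * M) := by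
        gcongr
        refine (Finset.abs_sum_le_sum_abs _ _).trans ?_
        simpa using Finset.sum_le_card_nsmul Finset.univ _ M fun k _ ↦ ha k
    _ = ((n : ℝ)⁻¹ * n) * M := by ring
    _ ≤ M := mul_le_of_le_one_left hM inv_mul_le_one

theorem bddAbove_range_of_abs_le {ι : Type*} {a : ι → ℝ} {B : ℝ} (h : ∀ i, |a i| ≤ B) :
    BddAbove (range a) :=
  ⟨B, by rintro _ ⟨i, rfl⟩; exact (abs_le.1 (h i)).2⟩

theorem abs_ciSup_le {ι : Type*} [Nonempty ι] {a : ι → ℝ} {B : ℝ} (h : ∀ i, |a i| ≤ B) :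
    |⨆ i, a i| ≤ B := by
  have i := Classical.arbitrary ι
  exact abs_le.2 ⟨(abs_le.1 (h i)).1.trans (le_ciSup (bddAbove_range_of_abs_le h) i),
    ciSup_le fun j ↦ (abs_le.1 (h j)).2⟩

section

variable {X ι : Type*} [TopologicalSpace X] [MeasurableSpace X] [OpensMeasurableSpace X]
  {φ : ι → X → ℝ} {B : ℝ}

theorem measurable_ciSup_of_continuous (hφ : ∀ i, Continuous (φ i)) (hB : ∀ i x, |φ i x| ≤ B) :
    Measurable fun x ↦ ⨆ i, φ i x :=
  (lowerSemicontinuous_ciSup (fun x ↦ bddAbove_range_of_abs_le fun i ↦ hB i x)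
    fun i ↦ (hφ i).lowerSemicontinuous).measurable

theorem integrable_ciSup_of_continuous [Nonempty ι] (ν : Measure X) [IsFiniteMeasure ν]
    (hφ : ∀ i, Continuous (φ i)) (hB : ∀ i x, |φ i x| ≤ B) :
    Integrable (fun x ↦ ⨆ i, φ i x) ν :=
  .of_bound (measurable_ciSup_of_continuous hφ hB).aestronglyMeasurable B
    (.of_forall fun x ↦ abs_ciSup_le fun i ↦ hB i x)

end

section

variable {E ι : Type*} [MeasurableSpace E] (μ : Measure E) [IsProbabilityMeasure μ] {n : ℕ}

/-- Exchanging the two samples in the coordinates selected by `σ` preserves the law of a pair of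
independent samples. -/
theorem measurePreserving_exchange (σ : Fin n → Bool) :
    MeasurePreserving
      (fun p : (Fin n → E) × (Fin n → E) ↦
        ((fun k ↦ if σ k then p.1 k else p.2 k), fun k ↦ if σ k then p.2 k else p.1 k))
      ((Measure.pi fun _ ↦ μ).prod (Measure.pi fun _ ↦ μ))
      ((Measure.pi fun _ ↦ μ).prod (Measure.pi fun _ ↦ μ)) := by
  have he := measurePreserving_arrowProdEquivProdArrow E E (Fin n) (fun _ ↦ μ) (fun _ ↦ μ)
  have hswap (k : Fin n) : MeasurePreserving
      (fun q : E × E ↦ if σ k then q else q.swap) (μ.prod μ) (μ.prod μ) := by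
    cases σ k
    · simpa using Measure.measurePreserving_swap
    · simpa using! MeasurePreserving.id _
  convert (he.comp (measurePreserving_pi _ _ hswap)).comp (he.symm _) using 1
  ext p k <;> cases h : σ k <;>
    simp [h, MeasurableEquiv.arrowProdEquivProdArrow, Equiv.arrowProdEquivProdArrow]

theorem integral_empAvg (hn : n ≠ 0) {f : E → ℝ} (hf : Integrable f μ) :
    ∫ x : Fin n → E, empAvg f x ∂(Measure.pi fun _ ↦ μ) = ∫ y, f y ∂μ := by
  have hk (k : Fin n) : ∫ x : Fin n → E, f (x k) ∂(Measure.pi fun _ ↦ μ) = ∫ y, f y ∂μ :=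
    integral_comp_eval (μ := fun _ : Fin n ↦ μ) hf.aestronglyMeasurable
  simp only [empAvg]
  rw [integral_const_mul, integral_finsetSum _ fun k _ ↦ integrable_comp_eval hf]
  simp [hk, hn]

variable [TopologicalSpace E] [SecondCountableTopology E] [BorelSpace E]
  {f : ι → E → ℝ} {M : ℝ}

theorem integrable_signedSup [Nonempty ι] (hM : 0 ≤ M) (hf : ∀ i, Continuous (f i))
    (hfM : ∀ i x, |f i x| ≤ M) (σ : Fin n → Bool) :
    Integrable (signedSup f σ) (Measure.pi fun _ ↦ μ) := by
  refine integrable_ciSup_of_continuous (B := M) _ (fun i ↦ ?_) fun i x ↦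
    abs_inv_mul_sum_le hM fun k ↦ ?_
  · have := hf i
    fun_prop
  · rw [abs_mul, abs_boolSign, one_mul]
    exact hfM i _

/-- Symmetrization with a fixed sign pattern. -/
theorem integral_ciSup_integral_sub_empAvg_le [Nonempty ι] (hn : n ≠ 0) (hM : 0 ≤ M)
    (hf : ∀ i, Continuous (f i)) (hfM : ∀ i x, |f i x| ≤ M) (σ : Fin n → Bool) :
    ∫ x : Fin n → E, ⨆ i, (∫ y, f i y ∂μ - empAvg (f i) x) ∂(Measure.pi fun _ ↦ μ) ≤
      ∫ x, signedSup f σ x ∂(Measure.pi fun _ ↦ μ) +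
        ∫ x, signedSup f (fun k ↦ !σ k) x ∂(Measure.pi fun _ ↦ μ) := by
  set ν : Measure (Fin n → E) := Measure.pi fun _ ↦ μ
  have hfi (i) : Integrable (f i) μ :=
    .of_bound (hf i).measurable.aestronglyMeasurable M (.of_forall fun x ↦ hfM i x)
  have hint (i) : |∫ y, f i y ∂μ| ≤ M := by
    simpa using norm_integral_le_of_norm_le_const (μ := μ) (f := f i) (.of_forall (hfM i))
  have havg (i) (x : Fin n → E) : |empAvg (f i) x| ≤ M := abs_inv_mul_sum_le hM fun k ↦ hfM i _
  have hcont (i) : Continuous fun x : Fin n → E ↦ empAvg (f i) x := by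
    have := hf i
    unfold empAvg
    fun_prop
  have havgi (i) : Integrable (fun x ↦ empAvg (f i) x) ν :=
    .of_bound (hcont i).measurable.aestronglyMeasurable M (.of_forall fun x ↦ havg i x)
  have hsub {a b : ℝ} (ha : |a| ≤ M) (hb : |b| ≤ M) : |a - b| ≤ M + M :=
    (abs_sub _ _).trans (add_le_add ha hb)
  let D : (Fin n → E) × (Fin n → E) → ℝ := fun p ↦ ⨆ i, (empAvg (f i) p.2 - empAvg (f i) p.1)
  have hDc (i) : Continuous fun p : (Fin n → E) × (Fin n → E) ↦
      empAvg (f i) p.2 - empAvg (f i) p.1 :=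
    ((hcont i).comp continuous_snd).sub ((hcont i).comp continuous_fst)
  have hDm : Measurable D := measurable_ciSup_of_continuous hDc fun i p ↦ hsub (havg i _) (havg i _)
  have hD : Integrable D (ν.prod ν) :=
    integrable_ciSup_of_continuous _ hDc fun i p ↦ hsub (havg i _) (havg i _)
  have hD' (x) : Integrable (fun x' ↦ D (x, x')) ν :=
    integrable_ciSup_of_continuous _ (fun i ↦ (hDc i).comp (Continuous.prodMk_right x))
      fun i x' ↦ hsub (havg i _) (havg i _)
  have hS := integrable_signedSup μ hM hf hfM σ
  have hS' := integrable_signedSup μ hM hf hfM fun k ↦ !σ k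
  have hsbdd (τ : Fin n → Bool) (x : Fin n → E) :
      BddAbove (range fun i ↦ (n : ℝ)⁻¹ * ∑ k, boolSign (τ k) * f i (x k)) :=
    bddAbove_range_of_abs_le fun i ↦ abs_inv_mul_sum_le hM fun k ↦ by
      rw [abs_mul, abs_boolSign, one_mul]; exact hfM i _
  have hT := measurePreserving_exchange μ σ
  calc ∫ x, ⨆ i, (∫ y, f i y ∂μ - empAvg (f i) x) ∂ν
      ≤ ∫ x, ∫ x', D (x, x') ∂ν ∂ν := by
        refine integral_mono (integrable_ciSup_of_continuous _
          (fun i ↦ continuous_const.sub (hcont i)) fun i x ↦ hsub (hint i) (havg i x))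
          hD.integral_prod_left fun x ↦ ciSup_le fun i ↦ ?_
        calc ∫ y, f i y ∂μ - empAvg (f i) x
            = ∫ x', (empAvg (f i) x' - empAvg (f i) x) ∂ν := by
              rw [integral_sub (havgi i) (integrable_const _), integral_empAvg μ hn (hfi i)]
              simp
          _ ≤ ∫ x', D (x, x') ∂ν :=
              integral_mono ((havgi i).sub (integrable_const _)) (hD' x) fun x' ↦
                le_ciSup (bddAbove_range_of_abs_le fun j ↦
                  hsub (havg j x') (havg j x)) i
    _ = ∫ p, D p ∂(ν.prod ν) := (integral_prod _ hD).symm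
    _ = ∫ p, D ((fun k ↦ if σ k then p.1 k else p.2 k), fun k ↦ if σ k then p.2 k else p.1 k)
          ∂(ν.prod ν) := by
        conv_lhs => rw [← hT.map_eq]
        exact integral_map hT.measurable.aemeasurable hDm.aestronglyMeasurable
    _ ≤ ∫ p, (signedSup f σ p.2 + signedSup f (fun k ↦ !σ k) p.1) ∂(ν.prod ν) := by
        refine integral_mono (hT.integrable_comp_of_integrable hD)
          ((hS.comp_snd ν).add (hS'.comp_fst ν)) fun p ↦ ciSup_le fun i ↦ ?_
        refine le_trans (le_of_eq ?_) (add_le_add (le_ciSup (hsbdd σ p.2) i)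
          (le_ciSup (hsbdd (fun k ↦ !σ k) p.1) i))
        simp only [empAvg]
        rw [← mul_sub, ← mul_add, ← Finset.sum_sub_distrib, ← Finset.sum_add_distrib]
        congr! 2 with k
        cases σ k <;> simp [boolSign, sub_eq_add_neg, add_comm]
    _ = _ := by
        rw [integral_add (hS.comp_snd ν) (hS'.comp_fst ν), integral_fun_snd, integral_fun_fst]
        simp [ν]

end

instance : IsProbabilityMeasure signMeasure := by
  unfold signMeasure; infer_instance

theorem measurePreserving_not_signMeasure :
    MeasurePreserving (fun b ↦ !b) signMeasure signMeasure := by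
  refine ⟨measurable_of_finite _, Measure.ext_of_singleton fun b ↦ ?_⟩
  rw [Measure.map_apply (measurable_of_finite _) (measurableSet_singleton _)]
  have : (fun b ↦ !b) ⁻¹' {b} = {!b} := by ext a; cases a <;> cases b <;> simp
  rw [this, signMeasure, PMF.toMeasure_apply_singleton _ _ (measurableSet_singleton _),
    PMF.toMeasure_apply_singleton _ _ (measurableSet_singleton _)]
  simp

section

variable {E ι : Type*} [MeasurableSpace E] (μ : Measure E) [IsProbabilityMeasure μ] {n : ℕ}
  [TopologicalSpace E] [SecondCountableTopology E] [BorelSpace E] {f : ι → E → ℝ} {M : ℝ}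

theorem radComp_range_eq [Nonempty ι] (hM : 0 ≤ M) (hf : ∀ i, Continuous (f i))
    (hfM : ∀ i x, |f i x| ≤ M) :
    radComp μ n (range f) = ∫ σ : Fin n → Bool, ∫ x, signedSup f σ x ∂(Measure.pi fun _ ↦ μ)
      ∂(Measure.pi fun _ ↦ signMeasure) := by
  have h (σ : Fin n → Bool) (x : Fin n → E) :
      (⨆ g : range f, (n : ℝ)⁻¹ * ∑ i, (if σ i then (1 : ℝ) else -1) * (g : E → ℝ) (x i)) =
        signedSup f σ x :=
    iSup_range' (fun g : E → ℝ ↦ (n : ℝ)⁻¹ * ∑ i, (if σ i then (1 : ℝ) else -1) * g (x i)) f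
  simp only [radComp, h]
  simp_rw [integral_fintype (μ := Measure.pi fun _ : Fin n ↦ signMeasure) .of_finite]
  simp_rw [smul_eq_mul]
  rw [integral_finsetSum _ fun σ _ ↦ (integrable_signedSup μ hM hf hfM σ).const_mul _]
  simp_rw [integral_const_mul]

theorem integral_not_signMeasure (Ψ : (Fin n → Bool) → ℝ) :
    ∫ σ, Ψ (fun k ↦ !σ k) ∂(Measure.pi fun _ ↦ signMeasure) =
      ∫ σ, Ψ σ ∂(Measure.pi fun _ ↦ signMeasure) := by
  have h := measurePreserving_pi (fun _ : Fin n ↦ signMeasure) (fun _ ↦ signMeasure)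
    fun _ ↦ measurePreserving_not_signMeasure
  conv_rhs => rw [← h.map_eq]
  exact (integral_map h.measurable.aemeasurable
    (measurable_of_finite _).aestronglyMeasurable).symm

/-- Rademacher symmetrization. -/
theorem integral_ciSup_integral_sub_empAvg_le_radComp [Nonempty ι] (hn : n ≠ 0) (hM : 0 ≤ M)
    (hf : ∀ i, Continuous (f i)) (hfM : ∀ i x, |f i x| ≤ M) :
    ∫ x : Fin n → E, ⨆ i, (∫ y, f i y ∂μ - empAvg (f i) x) ∂(Measure.pi fun _ ↦ μ) ≤
      2 * radComp μ n (range f) := by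
  let Ψ : (Fin n → Bool) → ℝ := fun σ ↦ ∫ x, signedSup f σ x ∂(Measure.pi fun _ ↦ μ)
  have h := integral_mono (μ := Measure.pi fun _ : Fin n ↦ signMeasure)
    (f := fun _ ↦ ∫ x : Fin n → E, ⨆ i, (∫ y, f i y ∂μ - empAvg (f i) x) ∂(Measure.pi fun _ ↦ μ))
    (g := fun σ ↦ Ψ σ + Ψ fun k ↦ !σ k) .of_finite .of_finite
    (fun σ ↦ integral_ciSup_integral_sub_empAvg_le μ hn hM hf hfM σ)
  rw [integral_add .of_finite .of_finite, integral_not_signMeasure] at h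
  rw [radComp_range_eq μ hM hf hfM, two_mul]
  simpa using h

theorem radComp_range_neg [Nonempty ι] (hM : 0 ≤ M) (hf : ∀ i, Continuous (f i))
    (hfM : ∀ i x, |f i x| ≤ M) :
    radComp μ n (range fun i x ↦ -f i x) = radComp μ n (range f) := by
  rw [radComp_range_eq μ hM hf hfM,
    radComp_range_eq (f := fun i x ↦ -f i x) μ hM (fun i ↦ (hf i).neg)
      (fun i x ↦ by rw [abs_neg]; exact hfM i x),
    ← integral_not_signMeasure]
  simp [signedSup, boolSign_not]

/-- One-sided uniform deviation bound for a family of functions with range in an interval of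
length one. -/
theorem measure_ciSup_integral_sub_empAvg_gt_le [Nonempty ι] (hn : n ≠ 0) {a : ℝ}
    (hf : ∀ i, Continuous (f i)) (hfa : ∀ i x, f i x ∈ Icc a (a + 1)) {t : ℝ} (ht : 0 ≤ t) :
    (Measure.pi fun _ : Fin n ↦ μ).real
        {x | 2 * radComp μ n (range f) + t < ⨆ i, (∫ y, f i y ∂μ - empAvg (f i) x)} ≤
      Real.exp (-2 * n * t ^ 2) := by
  set M : ℝ := |a| + 1
  have hM : 0 ≤ M := by positivity
  have hfM (i x) : |f i x| ≤ M := by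
    have := hfa i x
    exact abs_le.2 ⟨by linarith [neg_abs_le a, this.1], by linarith [le_abs_self a, this.2]⟩
  have hbound (i) (x : Fin n → E) : |∫ y, f i y ∂μ - empAvg (f i) x| ≤ M + M := by
    refine (abs_sub _ _).trans (add_le_add ?_ (abs_inv_mul_sum_le hM fun k ↦ hfM i _))
    simpa using norm_integral_le_of_norm_le_const (μ := μ) (f := f i) (.of_forall (hfM i))
  have hcont (i) : Continuous fun x : Fin n → E ↦ ∫ y, f i y ∂μ - empAvg (f i) x := by
    have := hf i
    unfold empAvg
    fun_prop
  have hsub := hasSubgaussianMGF_pi_of_bounded_differences μ (n : NNReal)⁻¹ n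
    (fun x ↦ ⨆ i, (∫ y, f i y ∂μ - empAvg (f i) x)) (measurable_ciSup_of_continuous hcont hbound)
    (M + M) (fun x ↦ abs_ciSup_le fun i ↦ hbound i x) fun x k y ↦ ciSup_le fun i ↦ by
      refine le_trans ?_ (add_le_add_left
        (le_ciSup (bddAbove_range_of_abs_le fun j ↦ hbound j x) i) _)
      have hsum : ∑ j, f i (x j) ≤ ∑ j, f i (Function.update x k y j) + 1 := by
        rw [← Finset.add_sum_erase _ _ (Finset.mem_univ k),
          ← Finset.add_sum_erase _ (fun j ↦ f i (Function.update x k y j)) (Finset.mem_univ k)]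
        have : ∑ j ∈ Finset.univ.erase k, f i (Function.update x k y j) =
            ∑ j ∈ Finset.univ.erase k, f i (x j) :=
          Finset.sum_congr rfl fun j hj ↦ by
            rw [Function.update_of_ne (Finset.ne_of_mem_erase hj)]
        rw [this, Function.update_self]
        linarith [(hfa i (x k)).2, (hfa i y).1]
      have := mul_le_mul_of_nonneg_left hsum (by positivity : (0 : ℝ) ≤ (n : ℝ)⁻¹)
      simp only [empAvg, NNReal.coe_inv, NNReal.coe_natCast]
      linarith
  refine (measureReal_mono fun x hx ↦ ?_).trans ((hsub.measure_ge_le ht).trans_eq ?_)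
  · have := integral_ciSup_integral_sub_empAvg_le_radComp μ hn hM hf hfM
    simp only [mem_ofPred_eq] at hx ⊢
    linarith
  · congr 1
    have : (n : ℝ) ≠ 0 := mod_cast hn
    push_cast
    field_simp

end

theorem ciInf_sub_ciInf_le_ciSup_sub {ι : Type*} [Nonempty ι] {a b : ι → ℝ}
    (ha : BddBelow (range a)) (hab : BddAbove (range fun i ↦ a i - b i)) :
    (⨅ i, a i) - ⨅ i, b i ≤ ⨆ i, (a i - b i) := by
  rw [sub_le_comm]
  refine le_ciInf fun i ↦ ?_
  linarith [ciInf_le ha i, le_ciSup hab i]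

theorem sig_mem_Icc (s t : ℝ) : sig s t ∈ Icc (0 : ℝ) 1 :=
  ⟨by unfold sig; positivity, by
    rw [sig, div_le_one (by positivity)]; linarith [Real.exp_pos (-t / s)]⟩

theorem continuous_sig (s : ℝ) : Continuous (sig s) :=
  continuous_const.div (by fun_prop) fun t ↦ by positivity

/-- Point-wise concentration of the empirical sphere depth:
`P(|SD^r_s(z|X_{1:n}) − SD^r_s(z|μ)| > 2 R_{μ,n}(F_z) + t) ≤ 2 exp(−n t²/2)`. -/
theorem stmt_15 (d : ℕ) (μ : Measure (EuclideanSpace ℝ (Fin d))) [IsProbabilityMeasure μ]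
    (z : EuclideanSpace ℝ (Fin d)) (r s : ℝ) (hr : 0 < r) (hs : 0 < s)
    (n : ℕ) (t : ℝ) (ht : 0 < t) :
    (Measure.pi fun _ : Fin n => μ)
      {x : Fin n → EuclideanSpace ℝ (Fin d) |
        2 * radComp μ n (Fz d r s z) + t < |SDemp d r s z n x - SDs d r s z μ|} ≤
      ENNReal.ofReal (2 * Real.exp (-(n : ℝ) * t ^ 2 / 2)) := by
  rcases eq_or_ne n 0 with rfl | hn
  · refine prob_le_one.trans ?_
    simp
  rcases isEmpty_or_nonempty (Metric.sphere z r) with hι | hι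
  · have hF : IsEmpty (Fz d r s z) := by
      refine ⟨fun ⟨_, c, hc, _⟩ ↦ hι.false ⟨c, ?_⟩⟩
      rwa [mem_sphere_iff_norm]
    simp [SDemp, SDs, radComp, Real.iSup_of_isEmpty, Real.iInf_of_isEmpty, not_lt.2 ht.le]
  let f : Metric.sphere z r → EuclideanSpace ℝ (Fin d) → ℝ :=
    fun c x ↦ sig s (r ^ 2 - ‖x - (c : EuclideanSpace ℝ (Fin d))‖ ^ 2)
  have hF : Fz d r s z = range f := by
    ext g
    simp [Fz, f, eq_comm]
  have hf (c) : Continuous (f c) := (continuous_sig s).comp (by fun_prop)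
  have hf01 (c x) : f c x ∈ Icc (0 : ℝ) 1 := sig_mem_Icc _ _
  have hf1 (c x) : |f c x| ≤ 1 := abs_le.2 ⟨by linarith [(hf01 c x).1], (hf01 c x).2⟩
  have hint (c) : |∫ x, f c x ∂μ| ≤ 1 := by
    simpa using norm_integral_le_of_norm_le_const (μ := μ) (f := f c) (.of_forall (hf1 c))
  have havg (c) (x : Fin n → EuclideanSpace ℝ (Fin d)) : |empAvg (f c) x| ≤ 1 :=
    abs_inv_mul_sum_le zero_le_one fun k ↦ hf1 c _
  have hupper := measure_ciSup_integral_sub_empAvg_gt_le μ hn (a := 0) hf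
    (by simpa using hf01) ht.le
  have hlower := measure_ciSup_integral_sub_empAvg_gt_le μ hn (a := -1)
    (f := fun c x ↦ -f c x) (fun c ↦ (hf c).neg)
    (fun c x ↦ ⟨neg_le_neg (hf01 c x).2, by linarith [(hf01 c x).1]⟩) ht.le
  rw [radComp_range_neg μ zero_le_one hf hf1] at hlower
  rw [hF, ← ofReal_measureReal]
  refine ENNReal.ofReal_le_ofReal ?_
  have hbdd {a : Metric.sphere z r → ℝ} (h : ∀ c, |a c| ≤ 1) : BddBelow (range a) :=
    ⟨-1, by rintro _ ⟨c, rfl⟩; exact (abs_le.1 (h c)).1⟩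
  have hbdd' {a b : Metric.sphere z r → ℝ} (ha : ∀ c, |a c| ≤ 1) (hb : ∀ c, |b c| ≤ 1) :
      BddAbove (range fun c ↦ a c - b c) :=
    bddAbove_range_of_abs_le fun c ↦ (abs_sub _ _).trans (add_le_add (ha c) (hb c))
  refine (measureReal_mono (fun x hx ↦ ?_)).trans
    ((measureReal_union_le _ _).trans ((add_le_add hupper hlower).trans ?_))
  · rcases lt_abs.1 (mem_ofPred.1 hx) with h | h
    · right
      refine h.trans_le ((ciInf_sub_ciInf_le_ciSup_sub (hbdd fun c ↦ havg c x)
        (hbdd' (fun c ↦ havg c x) hint)).trans_eq ?_)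
      congr with c
      simp [integral_neg, empAvg]
      ring
    · left
      rw [neg_sub] at h
      exact h.trans_le (ciInf_sub_ciInf_le_ciSup_sub (hbdd hint) (hbdd' hint fun c ↦ havg c x))
  · rw [← two_mul]
    gcongr
    nlinarith [mul_nonneg n.cast_nonneg (sq_nonneg t) (α := ℝ)]
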